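/- arXiv:1810.03221 — 5 statements merged into one kernel-verified Lean document; each statement's English description precedes it below -/
import Mathlib

section
/- One-dimensional weak positivity of the Lax–Friedrichs cell-average update (scalar core of Theorem 2.2, part 1): under the hypotheses in the context, the updated cell average satisfies ρ̄^{new} := (1/2) Σ_{r=0}^{k} w_r ρ_r + (τ/h) (ĥ_R − ĥ_L) ≥ 0. -/
/-- One-dimensional weak positivity of the Lax–Friedrichs cell-average update:
given nonnegative Gauss–Lobatto point values and neighbor traces, Lax–Friedrichs
coefficients dominating the interface velocities, and the CFL conditions
`τ(αL + v0) ≤ w0 h` and `τ(αR − vk) ≤ wk h`, the updated cell average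
`ρ̄ + (τ/h)(ĥ_R − ĥ_L)` is nonnegative. -/
theorem lax_friedrichs_weak_positivity_1d
    (k : ℕ) (hk : 1 ≤ k)
    (w : Fin (k + 1) → ℝ) (hw : ∀ r, 0 < w r) (hwsum : ∑ r, w r = 2)
    (ρ : Fin (k + 1) → ℝ) (hρ : ∀ r, 0 ≤ ρ r)
    (ρL ρR : ℝ) (hρL : 0 ≤ ρL) (hρR : 0 ≤ ρR)
    (vL v0 vk vR : ℝ) (αL αR : ℝ)
    (hαL : max |vL| |v0| ≤ αL) (hαR : max |vk| |vR| ≤ αR)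
    (h τ : ℝ) (hh : 0 < h) (hτ : 0 ≤ τ)
    (cflL : τ * (αL + v0) ≤ w 0 * h)
    (cflR : τ * (αR - vk) ≤ w (Fin.last k) * h) :
    0 ≤ (1 / 2) * ∑ r, w r * ρ r +
      (τ / h) *
        (((1 / 2) * (ρR * vR + ρ (Fin.last k) * vk) + (αR / 2) * (ρR - ρ (Fin.last k))) -
          ((1 / 2) * (ρ 0 * v0 + ρL * vL) + (αL / 2) * (ρ 0 - ρL))) := by
  have hne : (0 : Fin (k + 1)) ≠ Fin.last k := by
    intro e
    have := congrArg Fin.val e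
    simp at this
    omega
  have hsum : w 0 * ρ 0 + w (Fin.last k) * ρ (Fin.last k) ≤ ∑ r, w r * ρ r := by
    rw [← Finset.sum_pair (f := fun r => w r * ρ r) hne]
    exact Finset.sum_le_sum_of_subset_of_nonneg (Finset.subset_univ _)
      (fun r _ _ => mul_nonneg (hw r).le (hρ r))
  have hs : 0 ≤ τ / h := div_nonneg hτ hh.le
  have c1 : τ / h * (αL + v0) ≤ w 0 := by
    rw [div_mul_eq_mul_div, div_le_iff₀ hh]; exact cflL
  have c2 : τ / h * (αR - vk) ≤ w (Fin.last k) := by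
    rw [div_mul_eq_mul_div, div_le_iff₀ hh]; exact cflR
  have a1 : 0 ≤ αL - vL := by
    linarith [le_abs_self vL, le_max_left |vL| |v0|]
  have a2 : 0 ≤ αR + vR := by
    linarith [neg_abs_le vR, le_max_right |vk| |vR|]
  have p1 := mul_le_mul_of_nonneg_right c1 (hρ 0)
  have p2 := mul_le_mul_of_nonneg_right c2 (hρ (Fin.last k))
  have p3 := mul_nonneg hs (mul_nonneg a1 hρL)
  have p4 := mul_nonneg hs (mul_nonneg a2 hρR)
  generalize τ / h = s at *
  linarith
end

section
/- Positivity and conservation of the scaling limiter (Theorem 2.2, part 2, positivity and mean-preservation): under the hypotheses in the context, the scaling coefficient satisfies θ ∈ [0,1], the limited values p̃_r := p̄ + θ (p_r − p̄) satisfy p̃_r ≥ 0 for every r, and the weighted average is preserved: (1/2) Σ_{r=0}^{n} w_r p̃_r = p̄. -/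
/-- Positivity and conservation of the scaling limiter: given positive weights summing
to 2, point values `p r` with nonnegative weighted average `p̄` and minimum `m < p̄`,
the scaling coefficient `θ = min (p̄/(p̄ − m)) 1` lies in `[0,1]`, the limited values
`p̄ + θ(p r − p̄)` are nonnegative, and their weighted average is still `p̄`. -/
theorem scaling_limiter_positivity_and_conservation
    (n : ℕ) (w : Fin (n + 1) → ℝ) (hw : ∀ r, 0 < w r) (hwsum : ∑ r, w r = 2)
    (p : Fin (n + 1) → ℝ)
    (pbar : ℝ) (hpbar : pbar = (1 / 2) * ∑ r, w r * p r)
    (m : ℝ) (hm : m = Finset.univ.inf' Finset.univ_nonempty p)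
    (hpbar0 : 0 ≤ pbar) (hmlt : m < pbar)
    (θ : ℝ) (hθ : θ = min (pbar / (pbar - m)) 1) :
    θ ∈ Set.Icc (0 : ℝ) 1 ∧
    (∀ r, 0 ≤ pbar + θ * (p r - pbar)) ∧
    (1 / 2) * ∑ r, w r * (pbar + θ * (p r - pbar)) = pbar := by
  have hd : 0 < pbar - m := sub_pos.mpr hmlt
  have h0 : 0 ≤ θ := by
    rw [hθ]
    exact le_min (div_nonneg hpbar0 hd.le) zero_le_one
  have h1 : θ ≤ 1 := by
    rw [hθ]
    exact min_le_right _ _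
  have h2 : θ * (pbar - m) ≤ pbar := by
    rw [← le_div_iff₀ hd, hθ]
    exact min_le_left _ _
  refine ⟨⟨h0, h1⟩, ?_, ?_⟩
  · intro r
    have hr : m ≤ p r := by
      rw [hm]
      exact Finset.inf'_le p (Finset.mem_univ r)
    have h3 := mul_le_mul_of_nonneg_left hr h0
    linarith
  · have hs : ∑ r, w r * p r = 2 * pbar := by linarith
    have e : ∀ r, w r * (pbar + θ * (p r - pbar))
        = w r * (pbar - θ * pbar) + θ * (w r * p r) := fun r => by ring
    simp_rw [e]
    rw [Finset.sum_add_distrib, ← Finset.sum_mul, ← Finset.mul_sum, hwsum, hs]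
    ring
end

section
/- Gradient flow structure of the surfactant spreading model: let g ∈ ℝ. For all ρ1 ∈ ℝ and ρ2 > 0, the entropy density e(ρ1, ρ2) = (g/2)ρ1² + ρ2(log ρ2 − 1) has gradient ∇e(ρ) = (g ρ1, log ρ2), its Hessian at ρ is the diagonal matrix diag(g, 1/ρ2), and the matrix product F(ρ) · D²e(ρ) equals the diffusion matrix A(ρ) = [[(g/3)ρ1³, (1/2)ρ1²],[(g/2)ρ1²ρ2, ρ1ρ2]] of the divergence form of the system. -/
open Matrix Real

/-- Gradient flow structure of the surfactant spreading model: for `ρ1 ∈ ℝ` and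
`ρ2 > 0`, the entropy density `e(ρ) = (g/2)ρ1² + ρ2(log ρ2 − 1)` has gradient
`(gρ1, log ρ2)`, Hessian `diag(g, 1/ρ2)`, and the mobility matrix times the Hessian
equals the diffusion matrix `A(ρ) = [[(g/3)ρ1³, (1/2)ρ1²],[(g/2)ρ1²ρ2, ρ1ρ2]]`. -/
theorem surfactant_gradient_flow_structure
    (g : ℝ) (e : (Fin 2 → ℝ) → ℝ)
    (he : ∀ ρ : Fin 2 → ℝ,
      e ρ = (g / 2) * (ρ 0) ^ 2 + ρ 1 * (Real.log (ρ 1) - 1))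
    (ρ1 ρ2 : ℝ) (hρ2 : 0 < ρ2) :
    (∀ i : Fin 2,
        fderiv ℝ e ![ρ1, ρ2] (Pi.single i 1) = ![g * ρ1, Real.log ρ2] i) ∧
    (Matrix.of (fun i j : Fin 2 =>
        fderiv ℝ (fun w => fderiv ℝ e w (Pi.single j 1)) ![ρ1, ρ2] (Pi.single i 1))
      = Matrix.diagonal ![g, 1 / ρ2]) ∧
    (Matrix.diagonal ![ρ1, ρ2] * !![ρ1 ^ 2 / 3, ρ1 * ρ2 / 2; ρ1 ^ 2 / 2, ρ1 * ρ2] *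
        Matrix.diagonal ![g, 1 / ρ2]
      = !![(g / 3) * ρ1 ^ 3, (1 / 2) * ρ1 ^ 2; (g / 2) * ρ1 ^ 2 * ρ2, ρ1 * ρ2]) := by
  have hP : ∀ (i : Fin 2) (w : Fin 2 → ℝ),
      HasFDerivAt (fun v : Fin 2 → ℝ => v i)
        (ContinuousLinearMap.proj (R := ℝ) (φ := fun _ : Fin 2 => ℝ) i) w :=
    fun i w => hasFDerivAt_apply i w
  have hE : e = fun ρ => (g / 2) * (ρ 0) ^ 2 + ρ 1 * (Real.log (ρ 1) - 1) := funext he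
  have hD : ∀ w : Fin 2 → ℝ, 0 < w 1 → ∀ v : Fin 2 → ℝ,
      fderiv ℝ e w v = g * w 0 * v 0 + Real.log (w 1) * v 1 := by
    intro w hw v
    have h := (((hP 0 w).pow 2).const_mul (g / 2)).add
      ((hP 1 w).mul (((hP 1 w).log hw.ne').sub_const 1))
    have h2 := h.congr_of_eventuallyEq (f₁ := e) (Filter.Eventually.of_forall he)
    rw [h2.fderiv]
    simp
    field_simp
    ring
  have hev : ∀ᶠ w : Fin 2 → ℝ in nhds ![ρ1, ρ2], 0 < w 1 := by
    apply (continuous_apply (1 : Fin 2)).continuousAt.eventually_const_lt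
    simpa using hρ2
  have hH : ∀ v u : Fin 2 → ℝ,
      fderiv ℝ (fun w => fderiv ℝ e w v) ![ρ1, ρ2] u
        = g * v 0 * u 0 + 1 / ρ2 * v 1 * u 1 := by
    intro v u
    have hq : (fun w => fderiv ℝ e w v) =ᶠ[nhds ![ρ1, ρ2]]
        (fun w => g * w 0 * v 0 + Real.log (w 1) * v 1) :=
      hev.mono fun w hw => hD w hw v
    rw [hq.fderiv_eq]
    have hne : (![ρ1, ρ2] : Fin 2 → ℝ) 1 ≠ 0 := by simpa using hρ2.ne'
    have h : HasFDerivAt (fun w : Fin 2 → ℝ => g * w 0 * v 0 + Real.log (w 1) * v 1) _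
        ![ρ1, ρ2] := (((hP 0 _).const_mul g).mul_const (v 0)).add
      (((hP 1 _).log hne).mul_const (v 1))
    rw [h.fderiv]
    simp
    ring
  refine ⟨?_, ?_, ?_⟩
  · intro i
    rw [hD _ (by simpa using hρ2)]
    fin_cases i <;> simp
  · ext i j
    simp only [Matrix.of_apply, hH]
    fin_cases i <;> fin_cases j <;> simp
  · ext i j
    fin_cases i <;> fin_cases j <;>
      simp [Matrix.mul_apply, Fin.sum_univ_two, Matrix.diagonal] <;> field_simp
end

section
/- Energy decay for the seawater intrusion system: under the hypotheses in the context, for every time t the energy E(t) = ∫_{ℝ^d} (μ/2)(ρ1 + ρ2 + b)² + ((1−μ)/2)(ρ2 + b)² dx is differentiable in t with E'(t) = − ∫_{ℝ^d} μ² ρ1 |∇(ρ1 + ρ2 + b)|² + ρ2 |∇(μ ρ1 + ρ2 + b)|² dx ≤ 0; in particular, t ↦ E(t) is nonincreasing. -/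
open MeasureTheory

lemma aux_param {d : ℕ} (F : (Fin d → ℝ) → ℝ → ℝ)
    (hF : ContDiff ℝ 1 (fun p : (Fin d → ℝ) × ℝ => F p.1 p.2))
    (K : Set (Fin d → ℝ)) (hK : IsCompact K) (h0 : ∀ x ∉ K, ∀ t, F x t = 0) (t : ℝ) :
    HasDerivAt (fun s => ∫ x, F x s) (∫ x, deriv (fun s => F x s) t) t := by
  have hd : ∀ x s, HasDerivAt (fun s => F x s)
      (fderiv ℝ (fun p : (Fin d → ℝ) × ℝ => F p.1 p.2) (x, s) (0, 1)) s := by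
    intro x s
    have h1 := (hF.differentiable one_ne_zero (x, s)).hasFDerivAt
    have h2 : HasDerivAt (fun s : ℝ => (x, s)) ((0 : Fin d → ℝ), (1 : ℝ)) s :=
      (hasDerivAt_const s x).prodMk (hasDerivAt_id s)
    exact h1.comp_hasDerivAt s h2
  have hc : Continuous (fun p : (Fin d → ℝ) × ℝ =>
      fderiv ℝ (fun p : (Fin d → ℝ) × ℝ => F p.1 p.2) p (0, 1)) :=
    (hF.continuous_fderiv one_ne_zero).clm_apply continuous_const
  have hFc : ∀ s, Continuous (fun x => F x s) := fun s =>
    hF.continuous.comp (continuous_id.prodMk continuous_const)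
  obtain ⟨C, hC⟩ := (hK.prod (isCompact_Icc (a := t - 1) (b := t + 1))).exists_bound_of_continuousOn
    hc.continuousOn
  have hz : ∀ x ∉ K, ∀ s, fderiv ℝ (fun p : (Fin d → ℝ) × ℝ => F p.1 p.2) (x, s) (0, 1) = 0 := by
    intro x hx s
    rw [← (hd x s).deriv]
    simp [h0 x hx]
  have key := hasDerivAt_integral_of_dominated_loc_of_deriv_le (μ := (volume : Measure (Fin d → ℝ)))
    (F := fun s x => F x s) (x₀ := t) (s := Set.Icc (t - 1) (t + 1))
    (F' := fun s x => fderiv ℝ (fun p : (Fin d → ℝ) × ℝ => F p.1 p.2) (x, s) (0, 1))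
    (bound := K.indicator (fun _ => C))
    (Icc_mem_nhds (by linarith) (by linarith))
    (Filter.Eventually.of_forall fun s => (hFc s).aestronglyMeasurable)
    ((hFc t).integrable_of_hasCompactSupport (HasCompactSupport.intro hK fun x hx => h0 x hx t))
    (hc.comp (continuous_id.prodMk continuous_const)).aestronglyMeasurable
    (Filter.Eventually.of_forall fun x s hs => by
      by_cases hx : x ∈ K
      · rw [Set.indicator_of_mem hx]; exact hC (x, s) ⟨hx, hs⟩
      · rw [Set.indicator_of_notMem hx]; simp [hz x hx s])
    ((integrable_indicator_iff hK.measurableSet).2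
      (integrableOn_const hK.measure_lt_top.ne))
    (Filter.Eventually.of_forall fun x s _ => hd x s)
  have e : (fun x => deriv (fun s => F x s) t) =
      fun x => fderiv ℝ (fun p : (Fin d → ℝ) × ℝ => F p.1 p.2) (x, t) (0, 1) := by
    funext x; exact (hd x t).deriv
  rw [e]
  exact key.2

lemma aux_parts {d : ℕ} (u r : (Fin d → ℝ) → ℝ) (hu : ContDiff ℝ 2 u) (hr : ContDiff ℝ 1 r)
    (hs : HasCompactSupport r) :
    Integrable (fun x => u x * ∑ l : Fin d,
      fderiv ℝ (fun y => r y * fderiv ℝ u y (Pi.single l 1)) x (Pi.single l 1)) ∧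
    Integrable (fun x => r x * ∑ l : Fin d, (fderiv ℝ u x (Pi.single l 1)) ^ 2) ∧
    ∫ x, u x * ∑ l : Fin d,
      fderiv ℝ (fun y => r y * fderiv ℝ u y (Pi.single l 1)) x (Pi.single l 1)
      = - ∫ x, r x * ∑ l : Fin d, (fderiv ℝ u x (Pi.single l 1)) ^ 2 := by
  have hdu : ∀ l : Fin d, ContDiff ℝ 1 (fun y => fderiv ℝ u y (Pi.single l 1)) := fun l =>
    (hu.fderiv_right (m := 1) (by norm_num)).clm_apply contDiff_const
  have hg : ∀ l : Fin d, ContDiff ℝ 1 (fun y => r y * fderiv ℝ u y (Pi.single l 1)) := fun l =>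
    hr.mul (hdu l)
  have hgs : ∀ l : Fin d, HasCompactSupport (fun y => r y * fderiv ℝ u y (Pi.single l 1)) :=
    fun l => hs.mul_right
  have hgc : ∀ l : Fin d, Continuous (fun x =>
      fderiv ℝ (fun y => r y * fderiv ℝ u y (Pi.single l 1)) x (Pi.single l 1)) := fun l =>
    ((hg l).continuous_fderiv one_ne_zero).clm_apply continuous_const
  have hgs' : ∀ l : Fin d, HasCompactSupport (fun x =>
      fderiv ℝ (fun y => r y * fderiv ℝ u y (Pi.single l 1)) x (Pi.single l 1)) := fun l =>
    (hgs l).fderiv_apply ℝ (Pi.single l 1)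
  have i1 : ∀ l : Fin d, Integrable (fun x => u x *
      fderiv ℝ (fun y => r y * fderiv ℝ u y (Pi.single l 1)) x (Pi.single l 1)) := fun l =>
    (hu.continuous.mul (hgc l)).integrable_of_hasCompactSupport (hgs' l).mul_left
  have i2 : ∀ l : Fin d, Integrable (fun x => fderiv ℝ u x (Pi.single l 1) *
      (r x * fderiv ℝ u x (Pi.single l 1))) := fun l =>
    ((hdu l).continuous.mul (hg l).continuous).integrable_of_hasCompactSupport (hgs l).mul_left
  have i3 : ∀ l : Fin d, Integrable (fun x => u x *
      (r x * fderiv ℝ u x (Pi.single l 1))) := fun l =>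
    (hu.continuous.mul (hg l).continuous).integrable_of_hasCompactSupport (hgs l).mul_left
  have e1 : (fun x => u x * ∑ l : Fin d,
      fderiv ℝ (fun y => r y * fderiv ℝ u y (Pi.single l 1)) x (Pi.single l 1)) =
      fun x => ∑ l : Fin d, u x *
      fderiv ℝ (fun y => r y * fderiv ℝ u y (Pi.single l 1)) x (Pi.single l 1) := by
    funext x; rw [Finset.mul_sum]
  have e2 : (fun x => r x * ∑ l : Fin d, (fderiv ℝ u x (Pi.single l 1)) ^ 2) =
      fun x => ∑ l : Fin d, fderiv ℝ u x (Pi.single l 1) *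
      (r x * fderiv ℝ u x (Pi.single l 1)) := by
    funext x; rw [Finset.mul_sum]; exact Finset.sum_congr rfl fun l _ => by ring
  rw [e1, e2]
  refine ⟨integrable_finsetSum _ fun l _ => i1 l, integrable_finsetSum _ fun l _ => i2 l, ?_⟩
  rw [integral_finsetSum _ fun l _ => i1 l, integral_finsetSum _ fun l _ => i2 l,
    ← Finset.sum_neg_distrib]
  refine Finset.sum_congr rfl fun l _ => ?_
  exact integral_mul_fderiv_eq_neg_fderiv_mul_of_integrable (i2 l) (i1 l) (i3 l)
    (fun x _ => hu.differentiable two_ne_zero x)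
    (fun x _ => (hg l).differentiable one_ne_zero x)

/-- Energy decay for the seawater intrusion system: if `(ρ1, ρ2)` is a compactly
supported, nonnegative, smooth solution of
`∂_t ρ1 = ∇·(μ ρ1 ∇(ρ1 + ρ2 + b))`, `∂_t ρ2 = ∇·(ρ2 ∇(μ ρ1 + ρ2 + b))`
with `μ ∈ (0,1)` and a compactly supported smooth bedrock `b`, then the energy
`E(t) = ∫ (μ/2)(ρ1 + ρ2 + b)² + ((1−μ)/2)(ρ2 + b)² dx` is differentiable with
`E'(t) = − ∫ μ² ρ1 |∇(ρ1 + ρ2 + b)|² + ρ2 |∇(μ ρ1 + ρ2 + b)|² dx ≤ 0`;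
in particular `E` is nonincreasing. -/
theorem seawater_intrusion_energy_decay
    (d : ℕ) (hd : 1 ≤ d) (μ : ℝ) (hμ : μ ∈ Set.Ioo (0 : ℝ) 1)
    (b : (Fin d → ℝ) → ℝ) (hb : ContDiff ℝ 2 b)
    (ρ1 ρ2 : (Fin d → ℝ) → ℝ → ℝ)
    (hρ1 : ContDiff ℝ 2 (fun p : (Fin d → ℝ) × ℝ => ρ1 p.1 p.2))
    (hρ2 : ContDiff ℝ 2 (fun p : (Fin d → ℝ) × ℝ => ρ2 p.1 p.2))
    (hρ1nn : ∀ x t, 0 ≤ ρ1 x t) (hρ2nn : ∀ x t, 0 ≤ ρ2 x t)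
    (K : Set (Fin d → ℝ)) (hK : IsCompact K)
    (hbsupp : ∀ x ∉ K, b x = 0)
    (hsupp : ∀ x ∉ K, ∀ t : ℝ, ρ1 x t = 0 ∧ ρ2 x t = 0)
    (hpde1 : ∀ x t,
      deriv (fun s => ρ1 x s) t =
        ∑ l : Fin d,
          fderiv ℝ
            (fun y => μ * ρ1 y t *
              fderiv ℝ (fun y' => ρ1 y' t + ρ2 y' t + b y') y (Pi.single l 1))
            x (Pi.single l 1))
    (hpde2 : ∀ x t,
      deriv (fun s => ρ2 x s) t =
        ∑ l : Fin d,
          fderiv ℝ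
            (fun y => ρ2 y t *
              fderiv ℝ (fun y' => μ * ρ1 y' t + ρ2 y' t + b y') y (Pi.single l 1))
            x (Pi.single l 1)) :
    (∀ t : ℝ,
      HasDerivAt
        (fun s => ∫ x : Fin d → ℝ,
          (μ / 2) * (ρ1 x s + ρ2 x s + b x) ^ 2 +
            ((1 - μ) / 2) * (ρ2 x s + b x) ^ 2)
        (-(∫ x : Fin d → ℝ,
            μ ^ 2 * ρ1 x t *
              (∑ l : Fin d,
                (fderiv ℝ (fun y => ρ1 y t + ρ2 y t + b y) x (Pi.single l 1)) ^ 2) +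
            ρ2 x t *
              (∑ l : Fin d,
                (fderiv ℝ (fun y => μ * ρ1 y t + ρ2 y t + b y) x (Pi.single l 1)) ^ 2)))
        t ∧
      -(∫ x : Fin d → ℝ,
          μ ^ 2 * ρ1 x t *
            (∑ l : Fin d,
              (fderiv ℝ (fun y => ρ1 y t + ρ2 y t + b y) x (Pi.single l 1)) ^ 2) +
          ρ2 x t *
            (∑ l : Fin d,
              (fderiv ℝ (fun y => μ * ρ1 y t + ρ2 y t + b y) x (Pi.single l 1)) ^ 2)) ≤ 0) ∧
    Antitone (fun t => ∫ x : Fin d → ℝ,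
      (μ / 2) * (ρ1 x t + ρ2 x t + b x) ^ 2 +
        ((1 - μ) / 2) * (ρ2 x t + b x) ^ 2) := by
  have hmain : ∀ t : ℝ,
      HasDerivAt
        (fun s => ∫ x : Fin d → ℝ,
          (μ / 2) * (ρ1 x s + ρ2 x s + b x) ^ 2 +
            ((1 - μ) / 2) * (ρ2 x s + b x) ^ 2)
        (-(∫ x : Fin d → ℝ,
            μ ^ 2 * ρ1 x t *
              (∑ l : Fin d,
                (fderiv ℝ (fun y => ρ1 y t + ρ2 y t + b y) x (Pi.single l 1)) ^ 2) +
            ρ2 x t *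
              (∑ l : Fin d,
                (fderiv ℝ (fun y => μ * ρ1 y t + ρ2 y t + b y) x (Pi.single l 1)) ^ 2)))
        t := by
    intro t
    have hb' : ContDiff ℝ 2 (fun p : (Fin d → ℝ) × ℝ => b p.1) := hb.comp contDiff_fst
    have hE := aux_param (fun x s => (μ / 2) * (ρ1 x s + ρ2 x s + b x) ^ 2 +
            ((1 - μ) / 2) * (ρ2 x s + b x) ^ 2)
      (((contDiff_const.mul (((hρ1.add hρ2).add hb').pow 2)).add
        (contDiff_const.mul ((hρ2.add hb').pow 2))).of_le (by norm_num)) K hK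
      (fun x hx s => by simp [hbsupp x hx, hsupp x hx s]) t
    have hi : ContDiff ℝ 2 (fun x : Fin d → ℝ => (x, t)) := contDiff_id.prodMk contDiff_const
    have c1 : ContDiff ℝ 2 (fun x => ρ1 x t) := hρ1.comp hi
    have c2 : ContDiff ℝ 2 (fun x => ρ2 x t) := hρ2.comp hi
    have s1 : HasCompactSupport (fun x => μ * ρ1 x t) :=
      HasCompactSupport.intro hK fun x hx => by simp [hsupp x hx t]
    have s2 : HasCompactSupport (fun x => ρ2 x t) :=
      HasCompactSupport.intro hK fun x hx => by simp [hsupp x hx t]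
    obtain ⟨a1, a2, a3⟩ := aux_parts (fun y => ρ1 y t + ρ2 y t + b y) (fun x => μ * ρ1 x t)
      ((c1.add c2).add hb) ((contDiff_const.mul c1).of_le (by norm_num)) s1
    obtain ⟨b1, b2, b3⟩ := aux_parts (fun y => μ * ρ1 y t + ρ2 y t + b y) (fun x => ρ2 x t)
      (((contDiff_const.mul c1).add c2).add hb) (c2.of_le (by norm_num)) s2
    have ed : (fun x => deriv (fun s => (μ / 2) * (ρ1 x s + ρ2 x s + b x) ^ 2 +
            ((1 - μ) / 2) * (ρ2 x s + b x) ^ 2) t) = fun x =>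
        μ * ((ρ1 x t + ρ2 x t + b x) * ∑ l : Fin d,
          fderiv ℝ
            (fun y => μ * ρ1 y t *
              fderiv ℝ (fun y' => ρ1 y' t + ρ2 y' t + b y') y (Pi.single l 1))
            x (Pi.single l 1)) +
        (μ * ρ1 x t + ρ2 x t + b x) * ∑ l : Fin d,
          fderiv ℝ
            (fun y => ρ2 y t *
              fderiv ℝ (fun y' => μ * ρ1 y' t + ρ2 y' t + b y') y (Pi.single l 1))
            x (Pi.single l 1) := by
      funext x
      have hj : ContDiff ℝ 2 (fun s : ℝ => (x, s)) := contDiff_const.prodMk contDiff_id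
      have d1 : HasDerivAt (fun s => ρ1 x s) (deriv (fun s => ρ1 x s) t) t :=
        ((hρ1.comp hj).differentiable two_ne_zero t).hasDerivAt
      have d2 : HasDerivAt (fun s => ρ2 x s) (deriv (fun s => ρ2 x s) t) t :=
        ((hρ2.comp hj).differentiable two_ne_zero t).hasDerivAt
      rw [← hpde1 x t, ← hpde2 x t]
      have D := ((((d1.add d2).add_const (b x)).pow 2).const_mul (μ / 2)).add
        (((d2.add_const (b x)).pow 2).const_mul ((1 - μ) / 2))
      refine HasDerivAt.deriv (HasDerivAt.congr_deriv D ?_)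
      simp only [Pi.add_apply]
      push_cast
      ring
    refine hE.congr_deriv ?_
    rw [ed, integral_add (a1.const_mul μ) b1, integral_const_mul, a3, b3]
    have e3 : ∀ x, μ ^ 2 * ρ1 x t *
              (∑ l : Fin d,
                (fderiv ℝ (fun y => ρ1 y t + ρ2 y t + b y) x (Pi.single l 1)) ^ 2) =
        μ * (μ * ρ1 x t * (∑ l : Fin d,
                (fderiv ℝ (fun y => ρ1 y t + ρ2 y t + b y) x (Pi.single l 1)) ^ 2)) := by
      intro x; ring
    simp_rw [e3]
    rw [integral_add (a2.const_mul μ) b2, integral_const_mul]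
    ring
  have hneg : ∀ t : ℝ, -(∫ x : Fin d → ℝ,
          μ ^ 2 * ρ1 x t *
            (∑ l : Fin d,
              (fderiv ℝ (fun y => ρ1 y t + ρ2 y t + b y) x (Pi.single l 1)) ^ 2) +
          ρ2 x t *
            (∑ l : Fin d,
              (fderiv ℝ (fun y => μ * ρ1 y t + ρ2 y t + b y) x (Pi.single l 1)) ^ 2)) ≤ 0 := by
    intro t
    refine neg_nonpos.2 (integral_nonneg fun x => ?_)
    exact add_nonneg (mul_nonneg (mul_nonneg (sq_nonneg μ) (hρ1nn x t))
      (Finset.sum_nonneg fun l _ => sq_nonneg _))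
      (mul_nonneg (hρ2nn x t) (Finset.sum_nonneg fun l _ => sq_nonneg _))
  refine ⟨fun t => ⟨hmain t, hneg t⟩, ?_⟩
  refine antitone_of_deriv_nonpos (fun t => (hmain t).differentiableAt) fun t => ?_
  rw [(hmain t).deriv]
  exact hneg t
end

section
/- Two-dimensional weak positivity of the Lax–Friedrichs cell-average update (scalar core of Theorem 3.2, part 1): under the hypotheses in the context, the updated cell average satisfies ρ̄^{new} := (1/4) Σ_{r=0}^{k} Σ_{s=0}^{k} w_r w_s ρ(r,s) + (τ/(2 h_x)) Σ_{s=0}^{k} w_s (ĥ^x_R(s) − ĥ^x_L(s)) + (τ/(2 h_y)) Σ_{r=0}^{k} w_r (ĥ^y_T(r) − ĥ^y_B(r)) ≥ 0. -/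
theorem line_positivity_aux
    (k : ℕ) (hk : 1 ≤ k)
    (w : Fin (k + 1) → ℝ) (hw : ∀ r, 0 < w r)
    (u : Fin (k + 1) → ℝ) (hu : ∀ r, 0 ≤ u r)
    (a b vL v0 vk vR αL αR h τ : ℝ) (ha : 0 ≤ a) (hb : 0 ≤ b)
    (hαL : max |vL| |v0| ≤ αL) (hαR : max |vk| |vR| ≤ αR)
    (hh : 0 < h) (hτ : 0 ≤ τ)
    (cL : τ * (αL + v0) ≤ (1 / 2) * w 0 * h)
    (cR : τ * (αR - vk) ≤ (1 / 2) * w (Fin.last k) * h) :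
    0 ≤ (1 / 8) * ∑ r, w r * u r +
      (τ / (2 * h)) *
        (((1 / 2) * (b * vR + u (Fin.last k) * vk) + (αR / 2) * (b - u (Fin.last k))) -
          ((1 / 2) * (u 0 * v0 + a * vL) + (αL / 2) * (u 0 - a))) := by
  have hne : (0 : Fin (k + 1)) ≠ Fin.last k := by
    intro h0
    have := congrArg Fin.val h0
    simp at this
    omega
  have hsum : w 0 * u 0 + w (Fin.last k) * u (Fin.last k) ≤ ∑ r, w r * u r := by
    rw [← Finset.sum_pair (f := fun r => w r * u r) hne]
    exact Finset.sum_le_sum_of_subset_of_nonneg (Finset.subset_univ _)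
      (fun i _ _ => mul_nonneg (hw i).le (hu i))
  obtain ⟨c, hc⟩ : ∃ c, c = τ / (2 * h) := ⟨_, rfl⟩
  have hc0 : 0 ≤ c := by rw [hc]; positivity
  have hcτ : τ = c * (2 * h) := by rw [hc]; field_simp
  rw [← hc]
  have cL' : c * (αL + v0) ≤ w 0 / 4 := by
    rw [hcτ] at cL
    refine le_of_mul_le_mul_right ?_ hh
    linarith
  have cR' : c * (αR - vk) ≤ w (Fin.last k) / 4 := by
    rw [hcτ] at cR
    refine le_of_mul_le_mul_right ?_ hh
    linarith
  have h1 : 0 ≤ αL - vL := by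
    linarith [le_abs_self vL, le_max_left |vL| |v0|]
  have h2 : 0 ≤ αR + vR := by
    linarith [neg_abs_le vR, le_max_right |vk| |vR|]
  have e1 := mul_nonneg hc0 (mul_nonneg ha h1)
  have e2 := mul_nonneg hc0 (mul_nonneg hb h2)
  have e3 := mul_le_mul_of_nonneg_right cL' (hu 0)
  have e4 := mul_le_mul_of_nonneg_right cR' (hu (Fin.last k))
  linarith

/-- Two-dimensional weak positivity of the Lax–Friedrichs cell-average update:
given nonnegative Gauss–Lobatto node values and neighbor traces, Lax–Friedrichs
coefficients dominating the interface velocities, and the CFL conditions on all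
Gauss–Lobatto lines, the updated cell average is nonnegative. -/
theorem lax_friedrichs_weak_positivity_2d
    (k : ℕ) (hk : 1 ≤ k)
    (w : Fin (k + 1) → ℝ) (hw : ∀ r, 0 < w r) (hwsum : ∑ r, w r = 2)
    (ρ : Fin (k + 1) → Fin (k + 1) → ℝ) (hρ : ∀ r s, 0 ≤ ρ r s)
    (ρL ρR ρB ρT : Fin (k + 1) → ℝ)
    (hρL : ∀ s, 0 ≤ ρL s) (hρR : ∀ s, 0 ≤ ρR s)
    (hρB : ∀ r, 0 ≤ ρB r) (hρT : ∀ r, 0 ≤ ρT r)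
    (vxL vx0 vxk vxR : Fin (k + 1) → ℝ) (αxL αxR : Fin (k + 1) → ℝ)
    (hαxL : ∀ s, max |vxL s| |vx0 s| ≤ αxL s)
    (hαxR : ∀ s, max |vxk s| |vxR s| ≤ αxR s)
    (vyB vy0 vyk vyT : Fin (k + 1) → ℝ) (αyB αyT : Fin (k + 1) → ℝ)
    (hαyB : ∀ r, max |vyB r| |vy0 r| ≤ αyB r)
    (hαyT : ∀ r, max |vyk r| |vyT r| ≤ αyT r)
    (hx hy τ : ℝ) (hhx : 0 < hx) (hhy : 0 < hy) (hτ : 0 ≤ τ)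
    (cflxL : ∀ s, τ * (αxL s + vx0 s) ≤ (1 / 2) * w 0 * hx)
    (cflxR : ∀ s, τ * (αxR s - vxk s) ≤ (1 / 2) * w (Fin.last k) * hx)
    (cflyB : ∀ r, τ * (αyB r + vy0 r) ≤ (1 / 2) * w 0 * hy)
    (cflyT : ∀ r, τ * (αyT r - vyk r) ≤ (1 / 2) * w (Fin.last k) * hy) :
    0 ≤ (1 / 4) * ∑ r, ∑ s, w r * w s * ρ r s +
      (τ / (2 * hx)) *
        ∑ s, w s *
          (((1 / 2) * (ρR s * vxR s + ρ (Fin.last k) s * vxk s) +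
              (αxR s / 2) * (ρR s - ρ (Fin.last k) s)) -
            ((1 / 2) * (ρ 0 s * vx0 s + ρL s * vxL s) +
              (αxL s / 2) * (ρ 0 s - ρL s))) +
      (τ / (2 * hy)) *
        ∑ r, w r *
          (((1 / 2) * (ρT r * vyT r + ρ r (Fin.last k) * vyk r) +
              (αyT r / 2) * (ρT r - ρ r (Fin.last k))) -
            ((1 / 2) * (ρ r 0 * vy0 r + ρB r * vyB r) +
              (αyB r / 2) * (ρ r 0 - ρB r))) := by
  have hX := Finset.sum_nonneg (s := Finset.univ) (fun s _ => mul_nonneg (hw s).le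
    (line_positivity_aux k hk w hw (fun r => ρ r s) (fun r => hρ r s) (ρL s) (ρR s)
      (vxL s) (vx0 s) (vxk s) (vxR s) (αxL s) (αxR s) hx τ (hρL s) (hρR s)
      (hαxL s) (hαxR s) hhx hτ (cflxL s) (cflxR s)))
  have hY := Finset.sum_nonneg (s := Finset.univ) (fun r _ => mul_nonneg (hw r).le
    (line_positivity_aux k hk w hw (fun s => ρ r s) (fun s => hρ r s) (ρB r) (ρT r)
      (vyB r) (vy0 r) (vyk r) (vyT r) (αyB r) (αyT r) hy τ (hρB r) (hρT r)
      (hαyB r) (hαyT r) hhy hτ (cflyB r) (cflyT r)))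
  simp only [mul_add (w _) (1 / 8 * _), mul_left_comm (w _) (1 / 8),
    mul_left_comm (w _) (τ / _), Finset.sum_add_distrib, ← Finset.mul_sum] at hX hY
  have eY : ∑ r, w r * ∑ s, w s * ρ r s = ∑ r, ∑ s, w r * w s * ρ r s := by
    simp only [Finset.mul_sum, mul_assoc]
  have eX : ∑ s, w s * ∑ r, w r * ρ r s = ∑ r, ∑ s, w r * w s * ρ r s := by
    rw [Finset.sum_comm]
    refine Finset.sum_congr rfl fun s _ => ?_
    rw [Finset.mul_sum]
    exact Finset.sum_congr rfl fun r _ => by ring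
  rw [eX] at hX
  rw [eY] at hY
  linarith
end
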